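/- arXiv:2010.07147 — 5 statements merged into one kernel-verified Lean document; each statement's English description precedes it below -/
import Mathlib

section
/- Let $(X_i,Y_i)_{i=1}^{m+1}$ be independent with $(X_i,Y_i)\sim P_1$ for $1\le i\le m$ and $(X_{m+1},Y_{m+1})\sim P_2$, where $P_{1,X}$ and $P_{2,X}$ have densities $f_{1,X}$, $f_{2,X}$ with respect to a common base measure. Let $\tilde{\mathbf{Z}}$ denote the data sequence after a uniformly random permutation (equivalently, the unordered multiset of the $m+1$ data points). Under the null hypothesis $H_0$ of covariate shift, for any measurable conformity score function $V(x,y)$ and $V_i = V(X_i,Y_i)$, the conditional distribution of $V_{m+1}$ given $\tilde{\mathbf{Z}}$ is the discrete distribution $\sum_{i=1}^{m+1} p_i(\mathbf{Z})\,\delta_{V_i}$, where $p_i(\mathbf{Z}) = \big(f_{2,X}(X_i)/f_{1,X}(X_i)\big) \big/ \sum_{l=1}^{m+1} \big(f_{2,X}(X_l)/f_{1,X}(X_l)\big)$ and $\delta_v$ denotes the point mass at $v$. -/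
open MeasureTheory ProbabilityTheory

/-- The exchangeable (permutation-invariant) σ-algebra on `Fin (m+1) → E`: the σ-algebra
generated by the unordered (multiset) view `Z̃` of the data sequence. -/
def exchangeableSigma (m : ℕ) (E : Type*) [MeasurableSpace E] :
    MeasurableSpace (Fin (m + 1) → E) where
  MeasurableSet' A := MeasurableSet A ∧
    ∀ σ : Equiv.Perm (Fin (m + 1)), (fun z => z ∘ σ) ⁻¹' A = A
  measurableSet_empty := ⟨MeasurableSet.empty, fun _ => rfl⟩
  measurableSet_compl A hA := ⟨hA.1.compl, fun σ => by
    rw [Set.preimage_compl, hA.2 σ]⟩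
  measurableSet_iUnion f hf := ⟨MeasurableSet.iUnion fun i => (hf i).1, fun σ => by
    rw [Set.preimage_iUnion]; exact Set.iUnion_congr fun i => (hf i).2 σ⟩


lemma aux_P2 {X Y : Type*} [MeasurableSpace X] [MeasurableSpace Y]
    (P1 P2 : Measure (X × Y)) [IsProbabilityMeasure P1] [IsProbabilityMeasure P2]
    (κ1 κ2 : ProbabilityTheory.Kernel X Y) [IsMarkovKernel κ1] [IsMarkovKernel κ2]
    (hP1 : P1 = (P1.map Prod.fst) ⊗ₘ κ1)
    (hP2 : P2 = (P2.map Prod.fst) ⊗ₘ κ2)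
    (μX : Measure X) [SigmaFinite μX]
    (f1X f2X : X → ℝ) (hf1Xmeas : Measurable f1X) (hf2Xmeas : Measurable f2X)
    (hf1Xnonneg : ∀ x, 0 ≤ f1X x) 
    (hf1X : P1.map Prod.fst = μX.withDensity fun x => ENNReal.ofReal (f1X x))
    (hf2X : P2.map Prod.fst = μX.withDensity fun x => ENNReal.ofReal (f2X x))
    (hXac : P2.map Prod.fst ≪ P1.map Prod.fst)
    (hH0 : ∀ᵐ x ∂(P1.map Prod.fst), κ1 x = κ2 x) :
    P2 = P1.withDensity fun z => ENNReal.ofReal (f2X z.1 / f1X z.1) := by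
  have hr : Measurable fun x => ENNReal.ofReal (f2X x / f1X x) := by fun_prop
  have hm : P2.map Prod.fst = (P1.map Prod.fst).withDensity
      fun x => ENNReal.ofReal (f2X x / f1X x) := by
    have h0 : ∀ᵐ x ∂μX, ENNReal.ofReal (f2X x) ≠ 0 → f1X x ≠ 0 := by
      have : ∀ᵐ x ∂(P1.map Prod.fst), f1X x ≠ 0 := by
        rw [hf1X, ae_withDensity_iff (by fun_prop)]
        filter_upwards with x hx h
        simp [h] at hx
      have : ∀ᵐ x ∂(P2.map Prod.fst), f1X x ≠ 0 := hXac.ae_le this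
      rwa [hf2X, ae_withDensity_iff (by fun_prop)] at this
    rw [hf1X, ← withDensity_mul _ (by fun_prop) hr, hf2X]
    apply withDensity_congr_ae
    filter_upwards [h0] with x hx
    simp only [Pi.mul_apply]
    rw [← ENNReal.ofReal_mul (hf1Xnonneg x)]
    by_cases h : f1X x = 0
    · have : ENNReal.ofReal (f2X x) = 0 := by
        by_contra h'; exact hx h' h
      simp [h, this]
    · rw [mul_div_cancel₀ _ h]
  have hc := Measure.compProd_congr (μ := P1.map Prod.fst) (κ := κ1) (η := κ2) hH0
  rw [hc] at hP1
  have : IsFiniteMeasure ((P1.map Prod.fst).withDensity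
      fun x => ENNReal.ofReal (f2X x / f1X x)) := by rw [← hm]; infer_instance
  ext s hs
  rw [withDensity_apply _ hs, ← lintegral_indicator hs]
  conv_lhs => rw [hP2, Measure.compProd_apply hs, hm,
    lintegral_withDensity_eq_lintegral_mul _ hr (Kernel.measurable_kernel_prodMk_left hs)]
  conv_rhs => rw [hP1]
  rw [Measure.lintegral_compProd (by apply Measurable.indicator _ hs; fun_prop)]
  congr with x
  have : ∀ b, s.indicator (fun z : X × Y => ENNReal.ofReal (f2X z.1 / f1X z.1)) (x, b)
    = (Prod.mk x ⁻¹' s).indicator (fun _ => ENNReal.ofReal (f2X x / f1X x)) b := fun b => rfl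
  simp_rw [this]
  rw [lintegral_indicator_const (measurable_prodMk_left hs)]
  rfl

lemma aux_pi {E : Type*} [MeasurableSpace E] (m : ℕ) (P1 P2 : Measure E) [IsProbabilityMeasure P1]
    [IsProbabilityMeasure P2] (r : E → ℝ) (hr : Measurable r)
    (h : P2 = P1.withDensity fun z => ENNReal.ofReal (r z)) :
    (Measure.pi fun i : Fin (m+1) => if i = Fin.last m then P2 else P1) =
      (Measure.pi fun _ : Fin (m+1) => P1).withDensity
        fun z => ENNReal.ofReal (r (z (Fin.last m))) := by
  have : ∀ i : Fin (m+1), IsProbabilityMeasure (if i = Fin.last m then P2 else P1) := by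
    intro i; split_ifs <;> infer_instance
  symm
  refine (Measure.pi_eq (fun s hs => ?_)).symm
  have hS : MeasurableSet (Set.univ.pi s) := MeasurableSet.univ_pi hs
  let g : Fin (m+1) → E → ENNReal := fun i => (s i).indicator
    (fun x => if i = Fin.last m then ENNReal.ofReal (r x) else 1)
  have hg : ∀ i, Measurable (g i) := by
    intro i
    apply Measurable.indicator _ (hs i)
    split_ifs <;> fun_prop
  have hind : iIndepFun (fun i (z : Fin (m+1) → E) => g i (z i)) (Measure.pi fun _ : Fin (m+1) => P1) :=
    iIndepFun_pi (fun i => (hg i).aemeasurable)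
  have key := lintegral_prod_eq_prod_lintegral_of_indepFun Finset.univ _ hind
    (fun i => (hg i).comp (measurable_pi_apply i))
  rw [withDensity_apply _ hS, ← lintegral_indicator hS]
  trans ∫⁻ z, ∏ i, g i (z i) ∂(Measure.pi fun _ : Fin (m+1) => P1)
  · congr with z
    by_cases hz : z ∈ Set.univ.pi s
    · rw [Set.indicator_of_mem hz]
      have : ∀ i, g i (z i) = if i = Fin.last m then ENNReal.ofReal (r (z i)) else 1 := by
        intro i; exact Set.indicator_of_mem (hz i trivial) _
      simp [this]
    · rw [Set.indicator_of_notMem hz]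
      simp only [Set.mem_univ_pi, not_forall] at hz
      obtain ⟨i, hi⟩ := hz
      exact (Finset.prod_eq_zero (Finset.mem_univ i) (Set.indicator_of_notMem hi _)).symm
  · rw [key]
    refine Finset.prod_congr rfl fun i _ => ?_
    rw [(measurePreserving_eval (fun _ : Fin (m+1) => P1) i).lintegral_comp (hg i)]
    simp only [g]
    rw [lintegral_indicator (hs i)]
    split_ifs with hi
    · rw [h, withDensity_apply _ (hs i)]
    · simp

lemma aux_main {E : Type*} [MeasurableSpace E] (m : ℕ) (P1 P2 : Measure E)
    [IsProbabilityMeasure P1]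
    [IsProbabilityMeasure P2] (r : E → ℝ) (hr : Measurable r) (hr0 : ∀ x, 0 ≤ r x)
    (h : P2 = P1.withDensity fun z => ENNReal.ofReal (r z))
    (B : E → ℝ) (hB : Measurable B) (hB1 : ∀ x, ‖B x‖ ≤ 1)
    (μ : Measure (Fin (m + 1) → E))
    (hμ : μ = Measure.pi fun i => if i = Fin.last m then P2 else P1) :
    (μ[fun z => B (z (Fin.last m)) | exchangeableSigma m E])
      =ᵐ[μ] fun z => ∑ i : Fin (m + 1), (r (z i) / ∑ l, r (z l)) * B (z i) := by
  have hprob : ∀ i : Fin (m+1), IsProbabilityMeasure (if i = Fin.last m then P2 else P1) := by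
    intro i; split_ifs <;> infer_instance
  have hμp : IsProbabilityMeasure μ := by rw [hμ]; infer_instance
  have hle : exchangeableSigma m E ≤ MeasurableSpace.pi := fun s hs => hs.1
  set Q := Measure.pi fun _ : Fin (m+1) => P1 with hQ
  have hμQ : μ = Q.withDensity fun z => ENNReal.ofReal (r (z (Fin.last m))) := by
    rw [hμ, aux_pi m P1 P2 r hr h]
  have hrint : Integrable r P1 := by
    refine ⟨hr.aestronglyMeasurable, ?_⟩
    rw [hasFiniteIntegral_iff_ofReal (Filter.Eventually.of_forall hr0)]
    have h1 : P2 Set.univ = 1 := measure_univ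
    rw [h, withDensity_apply _ MeasurableSet.univ, setLIntegral_univ] at h1
    rw [h1]; exact ENNReal.one_lt_top
  have hri : ∀ i, Integrable (fun z : Fin (m+1) → E => r (z i)) Q := fun i =>
    (measurePreserving_eval (fun _ : Fin (m+1) => P1) i).integrable_comp_of_integrable hrint
  let w : Fin (m+1) → (Fin (m+1) → E) → ℝ := fun i z => (r (z i) / ∑ l, r (z l)) * B (z i)
  have hwm : ∀ i, Measurable (w i) := by intro i; fun_prop
  have hw1 : ∀ i z, ‖w i z‖ ≤ 1 := by
    intro i z
    have h0 : 0 ≤ ∑ l, r (z l) := Finset.sum_nonneg fun l _ => hr0 _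
    have h1 : r (z i) / ∑ l, r (z l) ≤ 1 :=
      div_le_one_of_le₀ (Finset.single_le_sum (f := fun l => r (z l))
        (fun l _ => hr0 _) (Finset.mem_univ i)) h0
    have h2 : 0 ≤ r (z i) / ∑ l, r (z l) := div_nonneg (hr0 _) h0
    simp only [w, norm_mul]
    rw [Real.norm_of_nonneg h2]
    exact mul_le_one₀ h1 (norm_nonneg _) (hB1 _)
  have hwint : ∀ i, Integrable (w i) μ := fun i =>
    Integrable.of_bound (hwm i).aestronglyMeasurable 1 (Filter.Eventually.of_forall (hw1 i))
  have hrw : ∀ i j, Integrable (fun z => r (z j) * w i z) Q := fun i j =>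
    (hri j).mul_bdd (c := 1) (hwm i).aestronglyMeasurable (Filter.Eventually.of_forall (hw1 i))
  have hinvσ : ∀ (σ : Equiv.Perm (Fin (m+1))) (z : Fin (m+1) → E),
      ∑ l, r ((z ∘ σ) l) = ∑ l, r (z l) := fun σ z => Equiv.sum_comp σ (fun l => r (z l))
  have hmp : ∀ σ : Equiv.Perm (Fin (m+1)),
      MeasurePreserving (fun z : Fin (m+1) → E => z ∘ σ) Q Q := by
    intro σ
    refine ⟨by fun_prop, ?_⟩
    refine (Measure.pi_eq (fun s hs => ?_)).symm
    rw [Measure.map_apply (by fun_prop) (MeasurableSet.univ_pi hs)]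
    have : (fun z : Fin (m+1) → E => z ∘ σ) ⁻¹' (Set.univ.pi s)
        = Set.univ.pi (fun i => s (σ.symm i)) := by
      ext z
      simp only [Set.mem_preimage, Set.mem_univ_pi, Function.comp]
      constructor
      · intro hz i; simpa using hz (σ.symm i)
      · intro hz i; simpa using hz (σ i)
    rw [this, hQ, Measure.pi_pi]
    exact Equiv.prod_comp σ.symm (fun i => P1 (s i))
  have hset : ∀ (S : Set (Fin (m+1) → E)), MeasurableSet S → ∀ g : (Fin (m+1) → E) → ℝ,
      ∫ z in S, g z ∂μ = ∫ z in S, r (z (Fin.last m)) * g z ∂Q := by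
    intro S hS g
    rw [hμQ, setIntegral_withDensity_eq_setIntegral_toReal_smul (by fun_prop)
      (Filter.Eventually.of_forall fun _ => ENNReal.ofReal_lt_top) _ hS]
    simp_rw [ENNReal.toReal_ofReal (hr0 _), smul_eq_mul]
  symm
  refine ae_eq_condExp_of_forall_setIntegral_eq hle ?_ ?_ ?_ ?_
  · exact Integrable.of_bound (hB.comp (measurable_pi_apply _)).aestronglyMeasurable 1 (Filter.Eventually.of_forall fun z => hB1 _)
  · intro s _ _
    exact (integrable_finsetSum _ fun i _ => hwint i).integrableOn
  · intro S hS _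
    have hS' : MeasurableSet S := hS.1
    change ∫ z in S, ∑ i, w i z ∂μ = _
    rw [integral_finsetSum _ fun i _ => (hwint i).integrableOn]
    simp_rw [hset S hS']
    have hswap : ∀ i, ∫ z in S, r (z (Fin.last m)) * w i z ∂Q
        = ∫ z in S, r (z i) * w (Fin.last m) z ∂Q := by
      intro i
      let σ := Equiv.swap i (Fin.last m)
      have hemb : MeasurableEmbedding (fun z : Fin (m+1) → E => z ∘ σ) := by
        let e : (Fin (m+1) → E) ≃ᵐ (Fin (m+1) → E) :=
          { toFun := fun z => z ∘ σ
            invFun := fun z => z ∘ σ.symm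
            left_inv := fun z => by ext; simp
            right_inv := fun z => by ext; simp
            measurable_toFun := by dsimp; fun_prop
            measurable_invFun := by dsimp; fun_prop }
        exact e.measurableEmbedding
      have := (hmp σ).setIntegral_preimage_emb hemb
        (fun z => r (z (Fin.last m)) * w i z) S
      rw [hS.2 σ] at this
      rw [← this]
      congr with z
      simp only [w]
      rw [hinvσ σ z]
      simp [σ]
    simp_rw [hswap]
    rw [← integral_finsetSum _ fun i _ => (hrw _ i).integrableOn]
    congr with z
    rw [← Finset.sum_mul]
    simp only [w]
    by_cases h0 : ∑ l, r (z l) = 0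
    · have := (Finset.sum_eq_zero_iff_of_nonneg (fun l _ => hr0 (z l))).1 h0
        (Fin.last m) (Finset.mem_univ _)
      rw [h0, this]; simp
    · field_simp
  · have hmeas : Measurable[exchangeableSigma m E] (fun z => ∑ i, w i z) := by
      intro T hT
      refine ⟨(show Measurable (fun z => ∑ i, w i z) by fun_prop) hT, fun σ => ?_⟩
      rw [← Set.preimage_comp]
      congr 1
      ext z
      simp only [w, Function.comp_apply]
      have := hinvσ σ z
      simp only [Function.comp_apply] at this
      rw [this]
      exact Equiv.sum_comp σ (fun i => (r (z i) / ∑ l, r (z l)) * B (z i))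
    exact (Measurable.stronglyMeasurable hmeas).aestronglyMeasurable

/-- **Lemma 2(a) (weighted conformal distribution).** On the canonical space
`Ω = Fin (m+1) → X × Y` carrying `m` i.i.d. points from `P₁` and a last point from `P₂`, under
the covariate-shift null hypothesis `H₀`, for any conformity score `V`, the conditional
distribution of `V_{m+1}` given the unordered data `Z̃` is `∑ᵢ pᵢ(Z) δ_{Vᵢ}` with
`pᵢ(Z) = (f_{2,X}(Xᵢ)/f_{1,X}(Xᵢ)) / ∑ₗ (f_{2,X}(Xₗ)/f_{1,X}(Xₗ))`; equivalently, for every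
measurable `A ⊆ ℝ`, `P(V_{m+1} ∈ A | Z̃) = ∑ᵢ pᵢ(Z) 1_A(Vᵢ)` a.s. -/
theorem stmt_1
    {X Y : Type*} [MeasurableSpace X] [MeasurableSpace Y]
    (P1 P2 : Measure (X × Y)) [IsProbabilityMeasure P1] [IsProbabilityMeasure P2]
    (κ1 κ2 : ProbabilityTheory.Kernel X Y) [IsMarkovKernel κ1] [IsMarkovKernel κ2]
    (hP1 : P1 = (P1.map Prod.fst) ⊗ₘ κ1)
    (hP2 : P2 = (P2.map Prod.fst) ⊗ₘ κ2)
    -- marginal densities f₁,X and f₂,X with respect to a common base measure μX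
    (μX : Measure X) [SigmaFinite μX]
    (f1X f2X : X → ℝ) (hf1Xmeas : Measurable f1X) (hf2Xmeas : Measurable f2X)
    (hf1Xnonneg : ∀ x, 0 ≤ f1X x) (hf2Xnonneg : ∀ x, 0 ≤ f2X x)
    (hf1X : P1.map Prod.fst = μX.withDensity fun x => ENNReal.ofReal (f1X x))
    (hf2X : P2.map Prod.fst = μX.withDensity fun x => ENNReal.ofReal (f2X x))
    -- mutual absolute continuity of the X-marginals
    (hXac : P1.map Prod.fst ≪ P2.map Prod.fst ∧ P2.map Prod.fst ≪ P1.map Prod.fst)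
    -- the null hypothesis H₀ of covariate shift
    (hH0 : ∀ᵐ x ∂(P1.map Prod.fst), κ1 x = κ2 x)
    -- an arbitrary measurable conformity score function
    (m : ℕ) (V : X × Y → ℝ) (hVmeas : Measurable V)
    -- the canonical probability space: m i.i.d. points from P₁ and one point from P₂
    (μ : Measure (Fin (m + 1) → X × Y))
    (hμ : μ = Measure.pi fun i => if i = Fin.last m then P2 else P1)
    -- the weights pᵢ(Z)
    (p : Fin (m + 1) → (Fin (m + 1) → X × Y) → ℝ)
    (hp : ∀ i z, p i z =
      (f2X (z i).1 / f1X (z i).1) / ∑ l : Fin (m + 1), f2X (z l).1 / f1X (z l).1) :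
    ∀ A : Set ℝ, MeasurableSet A →
      (μ[fun z => A.indicator (fun _ => (1:ℝ)) (V (z (Fin.last m))) |
          exchangeableSigma m (X × Y)])
        =ᵐ[μ] fun z => ∑ i : Fin (m + 1), p i z * A.indicator (fun _ => (1:ℝ)) (V (z i)) := by
  intro A hA
  have h := aux_P2 P1 P2 κ1 κ2 hP1 hP2 μX f1X f2X hf1Xmeas hf2Xmeas hf1Xnonneg hf1X hf2X
    hXac.2 hH0
  have := aux_main m P1 P2 (fun z => f2X z.1 / f1X z.1) (by fun_prop)
    (fun z => div_nonneg (hf2Xnonneg _) (hf1Xnonneg _)) h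
    (fun z => A.indicator (fun _ => (1:ℝ)) (V z))
    ((measurable_const.indicator hA).comp hVmeas)
    (fun z => by
      refine (norm_indicator_le_norm_self (fun _ => (1:ℝ)) (V z)).trans ?_
      simp) μ hμ
  simp_rw [hp]
  exact this
end

section
/- Let $V$ be a discrete random variable with finite support, let $F$ be its cumulative distribution function with left limit $F_-(v) = \lim_{u \uparrow v} F(u)$, and let $p(\cdot)$ be its probability mass function. Let $\zeta$ be a $U(0,1)$ random variable independent of $V$. Then $U = F_-(V) + \zeta\, p(V)$ has the uniform distribution on $[0,1]$. -/
open MeasureTheory ProbabilityTheory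

lemma aux_scale (a p : ℝ) (hp : 0 ≤ p) (A : Set ℝ) (hA : MeasurableSet A) :
    ENNReal.ofReal p * (volume.restrict (Set.Ioo (0:ℝ) 1)) {x | a + x * p ∈ A}
      = volume (A ∩ Set.Ioo a (a + p)) := by
  have hm : MeasurableSet {x : ℝ | a + x * p ∈ A} := by
    have : Measurable (fun x : ℝ => a + x * p) := by fun_prop
    exact this hA
  rcases hp.eq_or_lt with rfl | hp
  · simp
  rw [Measure.restrict_apply hm]
  have : {x : ℝ | a + x * p ∈ A} ∩ Set.Ioo (0:ℝ) 1
      = (fun x => x * p) ⁻¹' ((fun x => a + x) ⁻¹' (A ∩ Set.Ioo a (a + p))) := by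
    ext x
    simp only [Set.mem_inter_iff, Set.mem_setOf_eq, Set.mem_Ioo, Set.mem_preimage]
    refine and_congr_right fun _ => and_congr ?_ ?_
    · rw [lt_add_iff_pos_right, mul_pos_iff_of_pos_right hp]
    · rw [add_lt_add_iff_left, mul_lt_iff_lt_one_left hp]
  rw [this, Real.volume_preimage_mul_right hp.ne', measure_preimage_add, ← mul_assoc,
    ← ENNReal.ofReal_mul hp.le, abs_of_pos (inv_pos.2 hp), mul_inv_cancel₀ hp.ne']
  simp

/-- **Lemma (discrete CDF transform).** If `V` is a discrete random variable with finite
support, `F₋(v) = P(V < v)` the left limit of its CDF, `p(v) = P(V = v)` its probability mass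
function, and `ζ ∼ U(0,1)` independent of `V`, then `U = F₋(V) + ζ p(V)` is uniform on `[0,1]`. -/
theorem stmt_6
    {Ω : Type*} [MeasureSpace Ω] [IsProbabilityMeasure (ℙ : Measure Ω)]
    (V ζ : Ω → ℝ) (hV : Measurable V) (hζ : Measurable ζ)
    (hfin : (Set.range V).Finite)
    (hζlaw : Measure.map ζ ℙ = volume.restrict (Set.Ioo (0:ℝ) 1))
    (hindep : IndepFun V ζ ℙ)
    (U : Ω → ℝ)
    (hU : ∀ ω, U ω = (ℙ {ω' | V ω' < V ω}).toReal + ζ ω * (ℙ {ω' | V ω' = V ω}).toReal) :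
    Measure.map U ℙ = volume.restrict (Set.Ioo (0:ℝ) 1) := by
  classical
  set S := hfin.toFinset with hS
  have hVS : ∀ ω, V ω ∈ S := fun ω => by simp [hS]
  set a : ℝ → ℝ := fun v => (ℙ {ω' | V ω' < v}).toReal with ha
  set p : ℝ → ℝ := fun v => (ℙ {ω' | V ω' = v}).toReal with hp
  have hp0 : ∀ v, 0 ≤ p v := fun v => ENNReal.toReal_nonneg
  have ha0 : ∀ v, 0 ≤ a v := fun v => ENNReal.toReal_nonneg
  have mlt : ∀ v, MeasurableSet {ω' | V ω' < v} := fun v => hV measurableSet_Iio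
  have meq : ∀ v, MeasurableSet {ω' | V ω' = v} := fun v => hV (measurableSet_singleton v)
  have hap : ∀ v, a v + p v = (ℙ {ω' | V ω' ≤ v}).toReal := by
    intro v
    have h1 : {ω' | V ω' ≤ v} = {ω' | V ω' < v} ∪ {ω' | V ω' = v} := by
      ext ω; simp [le_iff_lt_or_eq]
    rw [h1, measure_union _ (meq v), ENNReal.toReal_add (measure_ne_top _ _) (measure_ne_top _ _)]
    rw [Set.disjoint_left]
    intro ω h h'
    exact (ne_of_lt h) h'
  have hap1 : ∀ v, a v + p v ≤ 1 := by
    intro v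
    rw [hap]
    exact ENNReal.toReal_mono ENNReal.one_ne_top prob_le_one
  have hle : ∀ v w, v < w → a v + p v ≤ a w := by
    intro v w h
    rw [hap]
    exact ENNReal.toReal_mono (measure_ne_top _ _) (measure_mono fun ω hω => lt_of_le_of_lt hω h)
  have hUm : Measurable U := by
    have h1 : U = fun ω => a (V ω) + ζ ω * p (V ω) := funext hU
    have hma : Measurable a := by
      apply Monotone.measurable
      intro v w h
      exact ENNReal.toReal_mono (measure_ne_top _ _)
        (measure_mono fun ω hω => lt_of_lt_of_le hω h)
    have hmap : Measurable fun v => a v + p v := by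
      apply Monotone.measurable
      intro v w h
      simp only [hap]
      exact ENNReal.toReal_mono (measure_ne_top _ _)
        (measure_mono fun ω hω => le_trans hω h)
    have hmp : Measurable p := by
      have := hmap.sub hma
      convert this using 1
      ext v
      simp
    rw [h1]
    exact (hma.comp hV).add (hζ.mul (hmp.comp hV))
  have hdisj : Set.PairwiseDisjoint (S : Set ℝ) (fun v => Set.Ioo (a v) (a v + p v)) := by
    intro v _ w _ hvw
    refine Set.disjoint_left.2 fun x hx hx' => ?_
    rcases lt_or_gt_of_ne hvw with h | h
    · linarith [hle _ _ h, hx.2, hx'.1]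
    · linarith [hle _ _ h, hx'.2, hx.1]
  have key : Measure.map U ℙ
      = volume.restrict (⋃ v ∈ S, Set.Ioo (a v) (a v + p v)) := by
    ext A hA
    rw [Measure.map_apply hUm hA, Measure.restrict_apply hA, Set.inter_iUnion₂,
      measure_biUnion_finset]
    · have hdec : U ⁻¹' A = ⋃ v ∈ S, (V ⁻¹' {v} ∩ ζ ⁻¹' {x | a v + x * p v ∈ A}) := by
        ext ω
        simp only [Set.mem_preimage, Set.mem_iUnion, Set.mem_inter_iff, Set.mem_singleton_iff,
          Set.mem_setOf_eq]
        rw [hU]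
        constructor
        · intro h
          exact ⟨V ω, hVS ω, rfl, h⟩
        · rintro ⟨v, _, rfl, h⟩
          exact h
      have hmA : ∀ v, MeasurableSet {x : ℝ | a v + x * p v ∈ A} := fun v => by
        have : Measurable (fun x : ℝ => a v + x * p v) := by fun_prop
        exact this hA
      rw [hdec, measure_biUnion_finset]
      · refine Finset.sum_congr rfl fun v _ => ?_
        rw [hindep.measure_inter_preimage_eq_mul _ _ (measurableSet_singleton v) (hmA v),
          ← Measure.map_apply hζ (hmA v), hζlaw, ← aux_scale _ _ (hp0 v) A hA]
        congr 1
        exact (ENNReal.ofReal_toReal (measure_ne_top _ _)).symm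
      · intro v _ w _ hvw
        refine Set.disjoint_left.2 fun ω h h' => hvw ?_
        exact h.1.symm.trans h'.1
      · intro v _
        exact (hV (measurableSet_singleton v)).inter (hζ (hmA v))
    · intro v hv w hw hvw
      exact (hdisj hv hw hvw).mono Set.inter_subset_right Set.inter_subset_right
    · intro v _
      exact hA.inter measurableSet_Ioo
  have : IsProbabilityMeasure (Measure.map U ℙ) := Measure.isProbabilityMeasure_map hUm.aemeasurable
  refine Measure.eq_of_le_of_measure_univ_eq ?_ ?_
  · rw [key]
    refine Measure.restrict_mono ?_ le_rfl
    refine Set.iUnion₂_subset fun v _ => Set.Ioo_subset_Ioo (ha0 v) (hap1 v)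
  · simp
end

section
/- Let $V$ be a non-degenerate nonnegative real-valued random variable with $\mathbb{E} V = 1$, and let $V'$ be an independent copy of $V$. Then $\mathbb{E}\big[V\,\mathbf{1}(V < V')\big] + \mathbb{E}\big[V\,\mathbf{1}(V \le V')\big] < 1$. -/
open MeasureTheory ProbabilityTheory

/-- **Lemma 4.** If `V` is a non-degenerate nonnegative random variable with `E V = 1` and `V'`
is an independent copy of `V`, then `E[V 1(V < V')] + E[V 1(V ≤ V')] < 1`. -/
theorem stmt_8
    {Ω : Type*} [MeasureSpace Ω] [IsProbabilityMeasure (ℙ : Measure Ω)]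
    (V V' : Ω → ℝ)
    (hVmeas : Measurable V) (hV'meas : Measurable V')
    (hnonneg : ∀ᵐ ω ∂ℙ, 0 ≤ V ω)
    (hint : Integrable V ℙ)
    (hmean : ∫ ω, V ω ∂ℙ = 1)
    (hindep : IndepFun V V' ℙ)
    (hcopy : Measure.map V' ℙ = Measure.map V ℙ)
    (hnondeg : ¬ ∃ c : ℝ, V =ᵐ[ℙ] fun _ => c) :
    (∫ ω, (if V ω < V' ω then V ω else 0) ∂ℙ)
      + (∫ ω, (if V ω ≤ V' ω then V ω else 0) ∂ℙ) < 1 := by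
  have hpm : Measurable fun ω => (V ω, V' ω) := hVmeas.prodMk hV'meas
  have hpm' : Measurable fun ω => (V' ω, V ω) := hV'meas.prodMk hVmeas
  have hp : Measure.map (fun ω => (V ω, V' ω)) ℙ = (Measure.map V ℙ).prod (Measure.map V ℙ) := by
    rw [(indepFun_iff_map_prod_eq_prod_map_map hVmeas.aemeasurable hV'meas.aemeasurable).1 hindep,
      hcopy]
  have hp' : Measure.map (fun ω => (V' ω, V ω)) ℙ = (Measure.map V ℙ).prod (Measure.map V ℙ) := by
    rw [(indepFun_iff_map_prod_eq_prod_map_map hV'meas.aemeasurable hVmeas.aemeasurable).1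
      hindep.symm, hcopy]
  have hid : IdentDistrib (fun ω => (V ω, V' ω)) (fun ω => (V' ω, V ω)) ℙ ℙ :=
    ⟨hpm.aemeasurable, hpm'.aemeasurable, hp.trans hp'.symm⟩
  have hidV : IdentDistrib V V' ℙ ℙ := ⟨hVmeas.aemeasurable, hV'meas.aemeasurable, hcopy.symm⟩
  have hint' : Integrable V' ℙ := hidV.integrable_snd hint
  have hg : Measurable fun p : ℝ × ℝ => if p.1 < p.2 then p.1 else 0 :=
    Measurable.ite (measurableSet_lt measurable_fst measurable_snd) measurable_fst measurable_const
  have hsw : ∫ ω, (if V ω < V' ω then V ω else 0) ∂ℙ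
      = ∫ ω, (if V' ω < V ω then V' ω else 0) ∂ℙ := (hid.comp hg).integral_eq
  have hi1 : Integrable (fun ω => if V' ω < V ω then V' ω else 0) ℙ := by
    have := hint'.indicator (measurableSet_lt hV'meas hVmeas)
    refine this.congr (Filter.Eventually.of_forall fun ω => ?_)
    simp [Set.indicator_apply]
  have hi2 : Integrable (fun ω => if V ω ≤ V' ω then V ω else 0) ℙ := by
    have := hint.indicator (measurableSet_le hVmeas hV'meas)
    refine this.congr (Filter.Eventually.of_forall fun ω => ?_)
    simp [Set.indicator_apply]
  have hmin : Integrable (fun ω => min (V ω) (V' ω)) ℙ := hint.inf hint'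
  rw [hsw, ← integral_add hi1 hi2]
  have he : ∀ ω, (if V' ω < V ω then V' ω else 0) + (if V ω ≤ V' ω then V ω else 0)
      = min (V ω) (V' ω) := by
    intro ω
    rcases lt_or_ge (V' ω) (V ω) with h | h
    · simp [h, h.le, not_le.2 h]
    · simp [h, not_lt.2 h]
  simp_rw [he]
  rw [← hmean]
  refine lt_of_le_of_ne (integral_mono hmin hint fun ω => min_le_left _ _) fun heq => hnondeg ?_
  have hz : ∫ ω, (V ω - min (V ω) (V' ω)) ∂ℙ = 0 := by
    rw [integral_sub hint hmin, heq, sub_self]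
  rw [integral_eq_zero_iff_of_nonneg (fun ω => sub_nonneg.2 (min_le_left _ _))
    (hint.sub hmin)] at hz
  have hle : ∀ᵐ ω ∂ℙ, V ω ≤ V' ω := by
    filter_upwards [hz] with ω h
    have h2 : V ω = min (V ω) (V' ω) := sub_eq_zero.1 h
    rw [h2]; exact min_le_right _ _
  have hms : MeasurableSet {p : ℝ × ℝ | p.1 ≤ p.2} := measurableSet_le measurable_fst measurable_snd
  have hle' : ∀ᵐ ω ∂ℙ, V' ω ≤ V ω := by
    have h1 := (ae_map_iff hpm.aemeasurable hms).2 hle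
    rw [hp, ← hp'] at h1
    exact (ae_map_iff hpm'.aemeasurable hms).1 h1
  have heq2 : ∀ᵐ p ∂((Measure.map V ℙ).prod (Measure.map V ℙ)), p.1 = p.2 := by
    rw [← hp, ae_map_iff hpm.aemeasurable (measurableSet_eq_fun measurable_fst measurable_snd)]
    filter_upwards [hle, hle'] with ω h h' using le_antisymm h h'
  have : IsProbabilityMeasure (Measure.map V ℙ) :=
    Measure.isProbabilityMeasure_map hVmeas.aemeasurable
  obtain ⟨x, hx⟩ := (Measure.ae_ae_of_ae_prod heq2).exists
  refine ⟨x, ?_⟩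
  filter_upwards [ae_of_ae_map hVmeas.aemeasurable hx] with ω h using h.symm
end

section
/- Let $(X_{1l},Y_{1l})\sim P_1$ and $(X_2,Y_2)\sim P_2$ be independent. Let $V(x,y) = f_1(y|x)/f_2(y|x)$, $g(x) = f_{2,X}(x)/f_{1,X}(x)$, and let $\hat{V}$ be a non-random measurable approximation of $V$. Write $V_{1l} = V(X_{1l},Y_{1l})$, $V_2 = V(X_2,Y_2)$, $\hat{V}_{1l} = \hat{V}(X_{1l},Y_{1l})$, $\hat{V}_2 = \hat{V}(X_2,Y_2)$, $g_{1l} = g(X_{1l})$. Then $\Big|\,\mathbb{E}\, g_{1l}\big[\mathbf{1}(\hat{V}_{1l} < \hat{V}_2) + \mathbf{1}(\hat{V}_{1l} \le \hat{V}_2)\big] - \mathbb{E}\, g_{1l}\big[\mathbf{1}(V_{1l} < V_2) + \mathbf{1}(V_{1l} \le V_2)\big]\,\Big| \le 4\,\|\hat{V} - V\|_{1,P_2}$. -/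
open MeasureTheory ProbabilityTheory
open scoped ENNReal

lemma aux_density {X Y : Type*} [MeasurableSpace X] [MeasurableSpace Y]
    (P1 P2 : Measure (X × Y)) [IsProbabilityMeasure P1] [IsProbabilityMeasure P2]
    (κ1 κ2 : ProbabilityTheory.Kernel X Y) [IsMarkovKernel κ1] [IsMarkovKernel κ2]
    (hP1 : P1 = (P1.map Prod.fst) ⊗ₘ κ1)
    (hP2 : P2 = (P2.map Prod.fst) ⊗ₘ κ2)
    (V : X → Y → ℝ) (hVmeas : Measurable (Function.uncurry V))
    (hV : ∀ x, κ1 x = (κ2 x).withDensity (fun y => ENNReal.ofReal (V x y)))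
    (g : X → ℝ) (hgmeas : Measurable g)
    (hg : P2.map Prod.fst = (P1.map Prod.fst).withDensity (fun x => ENNReal.ofReal (g x))) :
    P1.withDensity (fun z => ENNReal.ofReal (g z.1))
      = P2.withDensity (fun z => ENNReal.ofReal (V z.1 z.2)) := by
  have hV' : Measurable (fun z : X × Y => ENNReal.ofReal (V z.1 z.2)) := hVmeas.ennreal_ofReal
  have hg' : Measurable (fun x : X => ENNReal.ofReal (g x)) := hgmeas.ennreal_ofReal
  have hg2 : Measurable (fun x : X × Y => ENNReal.ofReal (g x.1)) := hg'.comp measurable_fst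
  have : IsProbabilityMeasure (P1.map Prod.fst) :=
    Measure.isProbabilityMeasure_map measurable_fst.aemeasurable
  have : IsProbabilityMeasure (P2.map Prod.fst) :=
    Measure.isProbabilityMeasure_map measurable_fst.aemeasurable
  ext s hs
  rw [withDensity_apply _ hs, withDensity_apply _ hs, ← lintegral_indicator hs,
    ← lintegral_indicator hs]
  conv_lhs => rw [hP1]
  conv_rhs => rw [hP2]
  rw [Measure.lintegral_compProd (hg2.indicator hs),
    Measure.lintegral_compProd (hV'.indicator hs), hg,
    lintegral_withDensity_eq_lintegral_mul _ hg' (hV'.indicator hs).lintegral_kernel_prod_right']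
  refine lintegral_congr fun x => ?_
  have hsx : MeasurableSet (Prod.mk x ⁻¹' s) := measurable_prodMk_left hs
  have hVx : Measurable (fun y => ENNReal.ofReal (V x y)) := hV'.comp measurable_prodMk_left
  have e1 : ∀ y, s.indicator (fun z : X × Y => ENNReal.ofReal (g z.1)) (x, y)
      = (Prod.mk x ⁻¹' s).indicator (fun _ => ENNReal.ofReal (g x)) y := fun y => rfl
  have e2 : ∀ y, s.indicator (fun z : X × Y => ENNReal.ofReal (V z.1 z.2)) (x, y)
      = (Prod.mk x ⁻¹' s).indicator (fun y => ENNReal.ofReal (V x y)) y := fun y => rfl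
  simp only [Pi.mul_apply, e1, e2]
  rw [lintegral_indicator hsx, lintegral_indicator hsx, setLIntegral_const, hV x,
    withDensity_apply _ hsx]

lemma aux_transfer {Z Ω : Type*} [MeasurableSpace Z] [MeasureSpace Ω]
    [IsProbabilityMeasure (ℙ : Measure Ω)]
    (P1 P2 : Measure Z) [IsProbabilityMeasure P1] [IsProbabilityMeasure P2]
    (G W : Z → ℝ) (hG : Measurable G) (hW : Measurable W)
    (hG0 : ∀ z, 0 ≤ G z) (hW0 : ∀ z, 0 ≤ W z)
    (h : P1.withDensity (fun z => ENNReal.ofReal (G z))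
      = P2.withDensity (fun z => ENNReal.ofReal (W z)))
    (Z1 Z2 : Ω → Z) (hZ1 : Measurable Z1) (hZ2 : Measurable Z2)
    (hindep : IndepFun Z1 Z2 ℙ)
    (hlaw1 : Measure.map Z1 ℙ = P1) (hlaw2 : Measure.map Z2 ℙ = P2)
    (s : Z × Z → ℝ) (hs : Measurable s) :
    ∫ ω, G (Z1 ω) * s (Z1 ω, Z2 ω) ∂ℙ = ∫ p, W p.1 * s p ∂(P2.prod P2) := by
  have hj : Measure.map (fun ω => (Z1 ω, Z2 ω)) ℙ = P1.prod P2 := by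
    rw [(indepFun_iff_map_prod_eq_prod_map_map hZ1.aemeasurable hZ2.aemeasurable).1 hindep,
      hlaw1, hlaw2]
  have key : ∀ (Q : Measure Z) [IsProbabilityMeasure Q] (F : Z → ℝ), Measurable F → (∀ z, 0 ≤ F z) →
      ∫ p, F p.1 * s p ∂(Q.prod P2)
        = ∫ p, s p ∂((Q.withDensity (fun z => ENNReal.ofReal (F z))).prod P2) := by
    intro Q _ F hF hF0
    rw [prod_withDensity_left hF.ennreal_ofReal,
      integral_withDensity_eq_integral_toReal_smul
        (show Measurable (fun z : Z × Z => ENNReal.ofReal (F z.1)) from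
          hF.ennreal_ofReal.comp measurable_fst) (by simp)]
    refine integral_congr_ae (Filter.Eventually.of_forall fun p => ?_)
    simp [ENNReal.toReal_ofReal (hF0 _)]
  rw [key P2 W hW hW0, ← h, ← key P1 G hG hG0, ← hj, integral_map]
  · exact (hZ1.prodMk hZ2).aemeasurable
  · exact ((hG.comp measurable_fst).mul hs).aestronglyMeasurable

/-- The sum of the two comparison indicators. -/
noncomputable def auxS {Z : Type*} (U : Z → ℝ) (p : Z × Z) : ℝ :=
  (if U p.1 < U p.2 then (1:ℝ) else 0) + (if U p.1 ≤ U p.2 then (1:ℝ) else 0)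

lemma auxS_meas {Z : Type*} [MeasurableSpace Z] (U : Z → ℝ) (hU : Measurable U) :
    Measurable (auxS U) := by
  have h1 : Measurable (fun p : Z × Z => U p.1) := hU.comp measurable_fst
  have h2 : Measurable (fun p : Z × Z => U p.2) := hU.comp measurable_snd
  exact (Measurable.ite (measurableSet_lt h1 h2) measurable_const measurable_const).add
    (Measurable.ite (measurableSet_le h1 h2) measurable_const measurable_const)

lemma auxS_swap {Z : Type*} (U : Z → ℝ) (p : Z × Z) : auxS U p.swap = 2 - auxS U p := by
  unfold auxS
  rcases lt_trichotomy (U p.1) (U p.2) with h | h | h <;>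
    simp only [Prod.fst_swap, Prod.snd_swap] <;> split_ifs <;> first | (exfalso; linarith) | norm_num

lemma auxS_bound {Z : Type*} (U : Z → ℝ) (p : Z × Z) : ‖auxS U p‖ ≤ 2 := by
  unfold auxS
  split_ifs <;> norm_num

lemma aux_pt {Z : Type*} (U W : Z → ℝ) (p : Z × Z) :
    |(W p.1 - W p.2) * (auxS U p - auxS W p)| ≤ 2 * (|U p.1 - W p.1| + |U p.2 - W p.2|) := by
  have a1 := le_abs_self (U p.1 - W p.1)
  have a2 := neg_abs_le (U p.1 - W p.1)
  have b1 := le_abs_self (U p.2 - W p.2)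
  have b2 := neg_abs_le (U p.2 - W p.2)
  unfold auxS
  rw [abs_le]
  split_ifs <;> constructor <;> linarith

lemma aux_main_s11 {Z : Type*} [MeasurableSpace Z] (P : Measure Z) [IsProbabilityMeasure P]
    (U W : Z → ℝ) (hU : Measurable U) (hW : Measurable W) (hWi : Integrable W P) :
    ENNReal.ofReal |∫ p, W p.1 * auxS U p ∂(P.prod P) - ∫ p, W p.1 * auxS W p ∂(P.prod P)|
      ≤ 4 * eLpNorm (fun z => U z - W z) 1 P := by
  have hW1 : Integrable (fun p : Z × Z => W p.1) (P.prod P) := hWi.comp_fst P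
  have hW2 : Integrable (fun p : Z × Z => W p.2) (P.prod P) := hWi.comp_snd P
  have i1 : ∀ T : Z → ℝ, Measurable T → Integrable (fun p => W p.1 * auxS T p) (P.prod P) :=
    fun T hT => hW1.mul_bdd (c := 2) (auxS_meas T hT).aestronglyMeasurable
      (Filter.Eventually.of_forall (auxS_bound T))
  have i2 : ∀ T : Z → ℝ, Measurable T → Integrable (fun p => W p.2 * auxS T p) (P.prod P) :=
    fun T hT => hW2.mul_bdd (c := 2) (auxS_meas T hT).aestronglyMeasurable
      (Filter.Eventually.of_forall (auxS_bound T))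
  have sw : ∀ T : Z → ℝ, Measurable T → ∫ p, W p.1 * auxS T p ∂(P.prod P)
      = 2 * ∫ p, W p.2 ∂(P.prod P) - ∫ p, W p.2 * auxS T p ∂(P.prod P) := by
    intro T hT
    rw [← integral_prod_swap, ← integral_const_mul, ← integral_sub (hW2.const_mul 2) (i2 T hT)]
    refine integral_congr_ae (Filter.Eventually.of_forall fun p => ?_)
    simp only [auxS_swap, Prod.fst_swap]
    ring
  by_cases hfin : Integrable (fun z => U z - W z) P
  · have hA1 : Integrable (fun p : Z × Z => |U p.1 - W p.1|) (P.prod P) := hfin.abs.comp_fst P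
    have hA2 : Integrable (fun p : Z × Z => |U p.2 - W p.2|) (P.prod P) := hfin.abs.comp_snd P
    have e : ∫ p, (W p.1 - W p.2) * (auxS U p - auxS W p) ∂(P.prod P)
        = 2 * (∫ p, W p.1 * auxS U p ∂(P.prod P) - ∫ p, W p.1 * auxS W p ∂(P.prod P)) := by
      have : ∀ p, (W p.1 - W p.2) * (auxS U p - auxS W p)
        = (W p.1 * auxS U p - W p.1 * auxS W p) - (W p.2 * auxS U p - W p.2 * auxS W p) := by
        intro p; ring
      simp only [this]
      have j1 : Integrable (fun p => W p.1 * auxS U p - W p.1 * auxS W p) (P.prod P) :=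
        (i1 U hU).sub (i1 W hW)
      have j2 : Integrable (fun p => W p.2 * auxS U p - W p.2 * auxS W p) (P.prod P) :=
        (i2 U hU).sub (i2 W hW)
      rw [integral_sub j1 j2,
        integral_sub (i1 U hU) (i1 W hW), integral_sub (i2 U hU) (i2 W hW)]
      linarith [sw U hU, sw W hW]
    have b : |∫ p, (W p.1 - W p.2) * (auxS U p - auxS W p) ∂(P.prod P)|
        ≤ ∫ p : Z × Z, 2 * (|U p.1 - W p.1| + |U p.2 - W p.2|) ∂(P.prod P) := by
      rw [← Real.norm_eq_abs]
      exact norm_integral_le_of_norm_le ((hA1.add hA2).const_mul 2)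
        (Filter.Eventually.of_forall (aux_pt U W))
    have c1 : ∫ p : Z × Z, |U p.1 - W p.1| ∂(P.prod P) = ∫ z, |U z - W z| ∂P := by
      simpa using integral_fun_fst (μ := P) (ν := P) (fun z => |U z - W z|)
    have c2 : ∫ p : Z × Z, |U p.2 - W p.2| ∂(P.prod P) = ∫ z, |U z - W z| ∂P := by
      simpa using integral_fun_snd (μ := P) (ν := P) (fun z => |U z - W z|)
    rw [integral_const_mul, integral_add hA1 hA2, c1, c2, e, abs_mul, abs_two] at b
    have n0 : 0 ≤ ∫ z, |U z - W z| ∂P := integral_nonneg fun z => abs_nonneg _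
    have r : eLpNorm (fun z => U z - W z) 1 P = ENNReal.ofReal (∫ z, |U z - W z| ∂P) := by
      rw [eLpNorm_one_eq_lintegral_enorm, ← ofReal_integral_norm_eq_lintegral_enorm hfin]
      rfl
    rw [r, show (4:ℝ≥0∞) = ENNReal.ofReal 4 by simp, ← ENNReal.ofReal_mul (by norm_num)]
    exact ENNReal.ofReal_le_ofReal (by linarith)
  · have : eLpNorm (fun z => U z - W z) 1 P = ⊤ := by
      by_contra hne
      exact hfin (memLp_one_iff_integrable.1
        ⟨(hU.sub hW).aestronglyMeasurable, lt_top_iff_ne_top.2 hne⟩)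
    rw [this]; simp

/-- **Lemma 5(b).** With `(X_{1l},Y_{1l}) ∼ P₁` and `(X₂,Y₂) ∼ P₂` independent, `g` the marginal
density ratio, `V` the conditional density ratio and `V̂` a non-random approximation of `V`,
`|E g_{1l}[1(V̂_{1l}<V̂₂)+1(V̂_{1l}≤V̂₂)] − E g_{1l}[1(V_{1l}<V₂)+1(V_{1l}≤V₂)]| ≤ 4‖V̂−V‖_{1,P₂}`. -/
theorem stmt_11
    {X Y : Type*} [MeasurableSpace X] [MeasurableSpace Y]
    (P1 P2 : Measure (X × Y)) [IsProbabilityMeasure P1] [IsProbabilityMeasure P2]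
    (κ1 κ2 : ProbabilityTheory.Kernel X Y) [IsMarkovKernel κ1] [IsMarkovKernel κ2]
    (hP1 : P1 = (P1.map Prod.fst) ⊗ₘ κ1)
    (hP2 : P2 = (P2.map Prod.fst) ⊗ₘ κ2)
    (V : X → Y → ℝ) (hVmeas : Measurable (Function.uncurry V)) (hVnonneg : ∀ x y, 0 ≤ V x y)
    (hV : ∀ x, κ1 x = (κ2 x).withDensity (fun y => ENNReal.ofReal (V x y)))
    (hκac : ∀ x, κ1 x ≪ κ2 x ∧ κ2 x ≪ κ1 x)
    (g : X → ℝ) (hgmeas : Measurable g) (hgnonneg : ∀ x, 0 ≤ g x)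
    (hg : P2.map Prod.fst = (P1.map Prod.fst).withDensity (fun x => ENNReal.ofReal (g x)))
    (hXac : P1.map Prod.fst ≪ P2.map Prod.fst ∧ P2.map Prod.fst ≪ P1.map Prod.fst)
    (Ω : Type*) [MeasureSpace Ω] [IsProbabilityMeasure (ℙ : Measure Ω)]
    (Z1 Z2 : Ω → X × Y) (hZ1 : Measurable Z1) (hZ2 : Measurable Z2)
    (hindep : IndepFun Z1 Z2 ℙ)
    (hlaw1 : Measure.map Z1 ℙ = P1) (hlaw2 : Measure.map Z2 ℙ = P2)
    (Vhat : X × Y → ℝ) (hVhat : Measurable Vhat) :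
    ENNReal.ofReal
        |(∫ ω, g (Z1 ω).1 * ((if Vhat (Z1 ω) < Vhat (Z2 ω) then (1:ℝ) else 0)
              + (if Vhat (Z1 ω) ≤ Vhat (Z2 ω) then (1:ℝ) else 0)) ∂ℙ)
          - (∫ ω, g (Z1 ω).1 * ((if V (Z1 ω).1 (Z1 ω).2 < V (Z2 ω).1 (Z2 ω).2 then (1:ℝ) else 0)
              + (if V (Z1 ω).1 (Z1 ω).2 ≤ V (Z2 ω).1 (Z2 ω).2 then (1:ℝ) else 0)) ∂ℙ)|
      ≤ 4 * eLpNorm (fun z : X × Y => Vhat z - V z.1 z.2) 1 P2 := by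
  have hd := aux_density P1 P2 κ1 κ2 hP1 hP2 V hVmeas hV g hgmeas hg
  have hWi : Integrable (fun z : X × Y => V z.1 z.2) P2 := by
    refine ⟨hVmeas.aestronglyMeasurable, ?_⟩
    rw [hasFiniteIntegral_iff_ofReal (Filter.Eventually.of_forall fun z => hVnonneg _ _),
      ← setLIntegral_univ, ← withDensity_apply _ MeasurableSet.univ, ← hd,
      withDensity_apply _ MeasurableSet.univ, setLIntegral_univ]
    have h1 : ∫⁻ z, ENNReal.ofReal (g z.1) ∂P1 = P2.map Prod.fst Set.univ := by
      rw [hg, withDensity_apply _ MeasurableSet.univ, setLIntegral_univ,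
        lintegral_map hgmeas.ennreal_ofReal measurable_fst]
    rw [h1, Measure.map_apply measurable_fst MeasurableSet.univ]
    exact measure_lt_top _ _
  have ht := aux_transfer P1 P2 (fun z => g z.1) (fun z => V z.1 z.2)
    (hgmeas.comp measurable_fst) hVmeas (fun _ => hgnonneg _) (fun _ => hVnonneg _ _) hd
    Z1 Z2 hZ1 hZ2 hindep hlaw1 hlaw2
  have hm := aux_main_s11 P2 Vhat (fun z => V z.1 z.2) hVhat hVmeas hWi
  rw [← ht _ (auxS_meas _ hVhat), ← ht _ (auxS_meas (fun z : X × Y => V z.1 z.2) hVmeas)] at hm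
  exact hm
end

section
/- Let $V_1,\dots,V_{m+1}$ be exchangeable real-valued random variables. Define $R_- = 1 + \sum_{i=1}^{m+1}\mathbf{1}(V_i < V_{m+1})$ and $R_+ = \sum_{i=1}^{m+1}\mathbf{1}(V_i \le V_{m+1})$, let $R$ be sampled uniformly from the integers in $[R_-, R_+]$ independently of everything else, and let $\zeta \sim U(0,1)$ be independent of everything else. Then $R$ is uniformly distributed on $\{1,\dots,m+1\}$, and consequently $U = (R - 1 + \zeta)/(m+1)$ has the uniform distribution on $[0,1]$. -/
open MeasureTheory ProbabilityTheory
open scoped ENNReal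


/-- conditional probability that the randomized rank of coordinate `i` is `j` -/
noncomputable def rkW {N : ℕ} (j : ℤ) (v : Fin N → ℝ) (i : Fin N) : ℝ≥0∞ :=
  if ((Finset.univ.filter fun k => v k < v i).card : ℤ) < j ∧
      j ≤ ((Finset.univ.filter fun k => v k ≤ v i).card : ℤ)
  then ((Finset.univ.filter fun k => v k = v i).card : ℝ≥0∞)⁻¹ else 0

lemma rk_card {N : ℕ} (v : Fin N → ℝ) (i : Fin N) :
    (Finset.univ.filter fun k => v k ≤ v i).card =
      (Finset.univ.filter fun k => v k < v i).card +
      (Finset.univ.filter fun k => v k = v i).card := by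
  rw [← Finset.card_union_of_disjoint]
  · congr 1
    ext k
    simp [le_iff_lt_or_eq]
  · rw [Finset.disjoint_filter]
    intro k _ h1 h2
    exact h1.ne h2

lemma rk_pos {N : ℕ} (v : Fin N → ℝ) (i : Fin N) :
    0 < (Finset.univ.filter fun k => v k = v i).card :=
  Finset.card_pos.2 ⟨i, by simp⟩

lemma rk_sum {N : ℕ} (j : ℤ) (h1 : 1 ≤ j) (h2 : j ≤ N) (v : Fin N → ℝ) :
    ∑ i, rkW j v i = 1 := by
  obtain ⟨q, rfl⟩ : ∃ q : ℕ, j = q + 1 := ⟨(j - 1).toNat, by omega⟩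
  have hq : q < N := by omega
  set σ := Tuple.sort v
  have hm : Monotone (v ∘ σ) := Tuple.monotone_sort v
  set i0 := σ ⟨q, hq⟩ with hi0
  have ha : (Finset.univ.filter fun k => v k < v i0).card ≤ q := by
    calc _ ≤ ((Finset.Iio (⟨q, hq⟩ : Fin N)).map σ.toEmbedding).card := by
          apply Finset.card_le_card
          intro k hk
          simp only [Finset.mem_filter, Finset.mem_univ, true_and] at hk
          simp only [Finset.mem_map, Finset.mem_Iio]
          refine ⟨σ.symm k, ?_, by simp⟩
          by_contra hc
          have := hm (not_lt.1 hc)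
          simp at this
          exact absurd hk (not_lt.2 this)
      _ = q := by simp
  have hb : q + 1 ≤ (Finset.univ.filter fun k => v k ≤ v i0).card := by
    calc q + 1 = ((Finset.Iic (⟨q, hq⟩ : Fin N)).map σ.toEmbedding).card := by simp
      _ ≤ _ := by
          apply Finset.card_le_card
          intro k hk
          simp only [Finset.mem_map, Finset.mem_Iic] at hk
          obtain ⟨l, hl, rfl⟩ := hk
          simp only [Finset.mem_filter, Finset.mem_univ, true_and]
          exact hm hl
  have key : ∀ i, rkW (q + 1 : ℤ) v i = if v i = v i0 then
      ((Finset.univ.filter fun k => v k = v i0).card : ℝ≥0∞)⁻¹ else 0 := by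
    intro i
    unfold rkW
    by_cases h : v i = v i0
    · rw [h, if_pos, if_pos rfl]
      constructor <;> omega
    · rw [if_neg h, if_neg]
      rintro ⟨c1, c2⟩
      rcases lt_or_gt_of_ne h with h | h
      · have : (Finset.univ.filter fun k => v k ≤ v i).card ≤
            (Finset.univ.filter fun k => v k < v i0).card := by
          apply Finset.card_le_card
          intro k
          simp only [Finset.mem_filter, Finset.mem_univ, true_and]
          intro hk; linarith
        omega
      · have : (Finset.univ.filter fun k => v k ≤ v i0).card ≤
            (Finset.univ.filter fun k => v k < v i).card := by
          apply Finset.card_le_card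
          intro k
          simp only [Finset.mem_filter, Finset.mem_univ, true_and]
          intro hk; linarith
        omega
  simp_rw [key]
  rw [← Finset.sum_filter, Finset.sum_const, nsmul_eq_mul]
  have := rk_pos v i0
  exact ENNReal.mul_inv_cancel (by exact_mod_cast this.ne') (by simp)

lemma rk_perm {N : ℕ} (j : ℤ) (v : Fin N → ℝ) (σ : Equiv.Perm (Fin N)) (i : Fin N) :
    rkW j (fun k => v (σ k)) i = rkW j v (σ i) := by
  have h : ∀ p : ℝ → Prop, ∀ [DecidablePred p],
      (Finset.univ.filter fun k => p (v (σ k))).card =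
      (Finset.univ.filter fun k => p (v k)).card := by
    intro p _
    rw [← Finset.card_map σ.toEmbedding]
    congr 1
    ext k
    simp only [Finset.mem_map, Finset.mem_filter, Finset.mem_univ, true_and]
    constructor
    · rintro ⟨a, ha, rfl⟩; exact ha
    · intro hk; exact ⟨σ.symm k, by simpa using hk, by simp⟩
  unfold rkW
  rw [h (fun x => x < v (σ i)), h (fun x => x ≤ v (σ i)), h (fun x => x = v (σ i))]

lemma rk_meas_card {N : ℕ} (p : Fin N → (Fin N → ℝ) → Prop) [∀ k v, Decidable (p k v)]
    (hp : ∀ k, MeasurableSet {v | p k v}) :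
    Measurable fun v => (Finset.univ.filter fun k => p k v).card := by
  simp_rw [Finset.card_filter]
  refine Finset.measurable_sum _ fun k _ => ?_
  exact Measurable.ite (hp k) measurable_const measurable_const

lemma rk_meas {N : ℕ} (j : ℤ) (i : Fin N) : Measurable fun v : Fin N → ℝ => rkW j v i := by
  have m1 : Measurable fun v : Fin N → ℝ => (Finset.univ.filter fun k => v k < v i).card :=
    rk_meas_card _ fun k => measurableSet_lt (measurable_pi_apply k) (measurable_pi_apply i)
  have m2 : Measurable fun v : Fin N → ℝ => (Finset.univ.filter fun k => v k ≤ v i).card :=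
    rk_meas_card _ fun k => measurableSet_le (measurable_pi_apply k) (measurable_pi_apply i)
  have m3 : Measurable fun v : Fin N → ℝ => (Finset.univ.filter fun k => v k = v i).card :=
    rk_meas_card _ fun k => measurableSet_eq_fun (measurable_pi_apply k) (measurable_pi_apply i)
  unfold rkW
  refine Measurable.ite ?_ ?_ measurable_const
  · exact (measurableSet_lt ((measurable_from_top (f := fun n : ℕ => (n : ℤ))).comp m1)
      measurable_const).inter
      (measurableSet_le measurable_const
        ((measurable_from_top (f := fun n : ℕ => (n : ℤ))).comp m2))
  · exact (measurable_from_top (f := fun n : ℕ => (n : ℝ≥0∞)⁻¹)).comp m3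

lemma floor_vol (n : ℕ) (hn : 0 < n) (d : ℤ) :
    (volume.restrict (Set.Ioo (0:ℝ) 1)) {x | ⌊x * (n : ℝ)⌋ = d} =
      if 0 ≤ d ∧ d < n then (n : ℝ≥0∞)⁻¹ else 0 := by
  have hn' : (0:ℝ) < n := by exact_mod_cast hn
  have hs : {x : ℝ | ⌊x * (n : ℝ)⌋ = d} = Set.Ico ((d:ℝ) / n) ((d + 1) / n) := by
    ext x
    simp only [Set.mem_ofPred_eq, Int.floor_eq_iff, Set.mem_Ico, div_le_iff₀ hn', lt_div_iff₀ hn']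
  rw [hs, Measure.restrict_congr_set (Ioo_ae_eq_Ico (μ := volume) (a := (0:ℝ)) (b := 1)),
    Measure.restrict_apply measurableSet_Ico]
  split_ifs with h
  · obtain ⟨h1, h2⟩ := h
    have e1 : (0:ℝ) ≤ d := by exact_mod_cast h1
    have e2 : (d:ℝ) + 1 ≤ n := by exact_mod_cast h2
    rw [Set.inter_eq_left.2, Real.volume_Ico]
    · rw [← sub_div, add_sub_cancel_left, one_div, ENNReal.ofReal_inv_of_pos hn',
        ENNReal.ofReal_natCast]
    · exact Set.Ico_subset_Ico (by positivity) ((div_le_one hn').2 e2)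
  · convert measure_empty (μ := (volume : Measure ℝ))
    ext x
    simp only [Set.mem_inter_iff, Set.mem_Ico, Set.mem_empty_iff_false, iff_false,
      div_le_iff₀ hn', lt_div_iff₀ hn']
    rintro ⟨⟨a1, a2⟩, a3, a4⟩
    apply h
    constructor
    · have : (-1:ℝ) < d := by nlinarith
      have : (-1:ℤ) < d := by exact_mod_cast this
      omega
    · have : (d:ℝ) < n := by nlinarith
      exact_mod_cast this

lemma vol_split (N : ℕ) (hN : 0 < N) (A : Set ℝ) (hA : MeasurableSet A) (n : ℕ) :
    volume (A ∩ Set.Ico (0:ℝ) ((n:ℝ) / N)) =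
      ∑ k ∈ Finset.range n, volume (A ∩ Set.Ico ((k:ℝ) / N) (((k:ℝ) + 1) / N)) := by
  have hN' : (0:ℝ) < N := by exact_mod_cast hN
  induction n with
  | zero => simp
  | succ n ih =>
    rw [Finset.sum_range_succ, ← ih, ← measure_union]
    · rw [← Set.inter_union_distrib_left, Set.Ico_union_Ico_eq_Ico (by positivity)
        (by gcongr; linarith)]
      push_cast; rfl
    · refine Set.disjoint_left.2 ?_
      rintro x ⟨_, _, h1⟩ ⟨_, h2, _⟩
      linarith
    · exact hA.inter measurableSet_Ico

lemma vol_scale (N : ℕ) (hN : 0 < N) (A : Set ℝ) (hA : MeasurableSet A) (k : ℕ) :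
    (N : ℝ≥0∞)⁻¹ * (volume.restrict (Set.Ioo (0:ℝ) 1)) {z | ((k:ℝ) + z) / N ∈ A} =
      volume (A ∩ Set.Ico ((k:ℝ) / N) (((k:ℝ) + 1) / N)) := by
  have hN' : (0:ℝ) < N := by exact_mod_cast hN
  have hm : MeasurableSet {z : ℝ | ((k:ℝ) + z) / N ∈ A} :=
    (show Measurable fun z : ℝ => ((k:ℝ) + z) / N by fun_prop) hA
  rw [Measure.restrict_congr_set (Ioo_ae_eq_Ico (μ := volume) (a := (0:ℝ)) (b := 1)),
    Measure.restrict_apply hm]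
  set B := A ∩ Set.Ico ((k:ℝ) / N) (((k:ℝ) + 1) / N) with hB
  have hs : {z : ℝ | ((k:ℝ) + z) / N ∈ A} ∩ Set.Ico 0 1 =
      (fun z => (k:ℝ) + z) ⁻¹' ((fun y => y * (N:ℝ)⁻¹) ⁻¹' B) := by
    ext z
    simp only [hB, Set.mem_inter_iff, Set.mem_ofPred_eq, Set.mem_Ico, Set.mem_preimage,
      ← div_eq_mul_inv, div_le_div_iff_of_pos_right hN', div_lt_div_iff_of_pos_right hN',
      le_add_iff_nonneg_right, add_lt_add_iff_left]
  rw [hs, measure_preimage_add, Real.volume_preimage_mul_right (by positivity), inv_inv,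
    abs_of_pos hN', ENNReal.ofReal_natCast, ← mul_assoc,
    ENNReal.inv_mul_cancel (by exact_mod_cast hN.ne') (by simp), one_mul]

/-- For exchangeable `V₁,…,V_{m+1}`, the rank `R` of `V_{m+1}` with ties broken uniformly at
random (realized here as `R = R₋ + ⌊η (R₊ − R₋ + 1)⌋` with `η ∼ U(0,1)` independent) is uniform
on `{1,…,m+1}`, and `U = (R − 1 + ζ)/(m+1)` with `ζ ∼ U(0,1)` independent is uniform on `[0,1]`. -/
theorem stmt_15
    {Ω : Type*} [MeasureSpace Ω] [IsProbabilityMeasure (ℙ : Measure Ω)]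
    (m : ℕ) (V : Fin (m + 1) → Ω → ℝ) (hVmeas : ∀ i, Measurable (V i))
    -- exchangeability of (V₁, …, V_{m+1})
    (hexch : ∀ σ : Equiv.Perm (Fin (m + 1)),
      Measure.map (fun ω => fun i => V (σ i) ω) ℙ = Measure.map (fun ω => fun i => V i ω) ℙ)
    (ζ η : Ω → ℝ) (hζ : Measurable ζ) (hη : Measurable η)
    (hζlaw : Measure.map ζ ℙ = volume.restrict (Set.Ioo (0:ℝ) 1))
    (hηlaw : Measure.map η ℙ = volume.restrict (Set.Ioo (0:ℝ) 1))
    -- (ζ, η) independent of the V's, and of each other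
    (hindep1 : IndepFun (fun ω => fun i => V i ω) (fun ω => (ζ ω, η ω)) ℙ)
    (hindep2 : IndepFun ζ η ℙ)
    -- R₋, R₊, the randomized rank R and the statistic U
    (Rm Rp : Ω → ℕ)
    (hRm : ∀ ω, Rm ω = 1 + (Finset.univ.filter fun i => V i ω < V (Fin.last m) ω).card)
    (hRp : ∀ ω, Rp ω = (Finset.univ.filter fun i => V i ω ≤ V (Fin.last m) ω).card)
    (R : Ω → ℤ)
    (hR : ∀ ω, R ω = (Rm ω : ℤ) + ⌊η ω * ((Rp ω : ℝ) - Rm ω + 1)⌋)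
    (U : Ω → ℝ)
    (hU : ∀ ω, U ω = ((R ω : ℝ) - 1 + ζ ω) / (m + 1)) :
    (∀ j : ℤ, 1 ≤ j → j ≤ m + 1 → ℙ {ω | R ω = j} = (m + 1 : ℝ≥0∞)⁻¹)
    ∧ Measure.map U ℙ = volume.restrict (Set.Ioo (0:ℝ) 1) := by
  classical
  set W : Ω → (Fin (m + 1) → ℝ) := fun ω i => V i ω with hW
  have hWm : Measurable W := measurable_pi_iff.2 hVmeas
  set lam : Measure ℝ := volume.restrict (Set.Ioo (0:ℝ) 1) with hlam
  have : IsProbabilityMeasure lam := by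
    rw [← hζlaw]; exact Measure.isProbabilityMeasure_map hζ.aemeasurable
  set μ : Measure (Fin (m + 1) → ℝ) := Measure.map W ℙ with hμ
  have : IsProbabilityMeasure μ := Measure.isProbabilityMeasure_map hWm.aemeasurable
  -- joint laws
  have hζη : Measure.map (fun ω => (ζ ω, η ω)) ℙ = lam.prod lam := by
    rw [(indepFun_iff_map_prod_eq_prod_map_map hζ.aemeasurable hη.aemeasurable).1 hindep2,
      hζlaw, hηlaw]
  have hall : Measure.map (fun ω => (W ω, (ζ ω, η ω))) ℙ = μ.prod (lam.prod lam) := by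
    rw [(indepFun_iff_map_prod_eq_prod_map_map hWm.aemeasurable
      (hζ.prodMk hη).aemeasurable).1 hindep1, hζη]
  have mp1 : MeasurePreserving (fun ω => (W ω, (ζ ω, η ω))) ℙ (μ.prod (lam.prod lam)) :=
    ⟨hWm.prodMk (hζ.prodMk hη), hall⟩
  have mp2 : MeasurePreserving (fun ω => ((W ω, ζ ω), η ω)) ℙ ((μ.prod lam).prod lam) :=
    (measurePreserving_prodAssoc μ lam lam).symm.comp mp1
  have mp3 : MeasurePreserving (fun ω => ((ζ ω, W ω), η ω)) ℙ ((lam.prod μ).prod lam) :=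
    ((Measure.measurePreserving_swap (μ := μ) (ν := lam)).prod
      (MeasurePreserving.id lam)).comp mp2
  have mp4 : MeasurePreserving (fun ω => (ζ ω, (W ω, η ω))) ℙ (lam.prod (μ.prod lam)) :=
    (measurePreserving_prodAssoc lam μ lam).comp mp3
  have mp5 : MeasurePreserving (fun ω => (W ω, η ω)) ℙ (μ.prod lam) :=
    measurePreserving_snd.comp mp4
  -- the rank as a function of the pair
  set F : (Fin (m + 1) → ℝ) × ℝ → ℤ := fun p =>
    1 + ((Finset.univ.filter fun k => p.1 k < p.1 (Fin.last m)).card : ℤ) +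
      ⌊p.2 * ((Finset.univ.filter fun k => p.1 k = p.1 (Fin.last m)).card : ℝ)⌋ with hF
  have hRF : ∀ ω, R ω = F (W ω, η ω) := by
    intro ω
    rw [hR, hRp, hRm, hF]
    have := rk_card (W ω) (Fin.last m)
    simp only [hW] at this ⊢
    rw [this]
    push_cast
    congr 3
    ring
  have m1 : Measurable fun v : Fin (m + 1) → ℝ =>
      (Finset.univ.filter fun k => v k < v (Fin.last m)).card :=
    rk_meas_card _ fun k => measurableSet_lt (measurable_pi_apply k) (measurable_pi_apply _)
  have m3 : Measurable fun v : Fin (m + 1) → ℝ =>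
      (Finset.univ.filter fun k => v k = v (Fin.last m)).card :=
    rk_meas_card _ fun k => measurableSet_eq_fun (measurable_pi_apply k) (measurable_pi_apply _)
  have hFm : Measurable F := by
    have a1 : Measurable fun p : (Fin (m + 1) → ℝ) × ℝ =>
        ((Finset.univ.filter fun k => p.1 k < p.1 (Fin.last m)).card : ℤ) :=
      (measurable_from_top (f := fun n : ℕ => (n : ℤ))).comp (m1.comp measurable_fst)
    have a3 : Measurable fun p : (Fin (m + 1) → ℝ) × ℝ =>
        ((Finset.univ.filter fun k => p.1 k = p.1 (Fin.last m)).card : ℝ) :=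
      (measurable_from_top (f := fun n : ℕ => (n : ℝ))).comp (m3.comp measurable_fst)
    exact (measurable_const.add a1).add (measurable_snd.mul a3).floor
  have hRm' : Measurable R := by
    have : R = fun ω => F (W ω, η ω) := funext hRF
    rw [this]; exact hFm.comp (hWm.prodMk hη)
  have part1 : ∀ j : ℤ, 1 ≤ j → j ≤ m + 1 → ℙ {ω | R ω = j} = (m + 1 : ℝ≥0∞)⁻¹ := by
    intro j h1 h2
    have hj : MeasurableSet {p | F p = j} := hFm (measurableSet_singleton j)
    have e1 : ℙ {ω | R ω = j} = ∫⁻ v, rkW j v (Fin.last m) ∂μ := by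
      have : {ω | R ω = j} = (fun ω => (W ω, η ω)) ⁻¹' {p | F p = j} := by
        ext ω; simp [hRF]
      rw [this, mp5.measure_preimage hj.nullMeasurableSet, Measure.prod_apply hj]
      refine lintegral_congr fun v => ?_
      have hc := rk_card v (Fin.last m)
      have hp := rk_pos v (Fin.last m)
      have : (Prod.mk v ⁻¹' {p | F p = j}) =
          {x : ℝ | ⌊x * ((Finset.univ.filter fun k => v k = v (Fin.last m)).card : ℝ)⌋ =
            j - 1 - ((Finset.univ.filter fun k => v k < v (Fin.last m)).card : ℤ)} := by
        ext x
        simp only [hF, Set.mem_preimage, Set.mem_ofPred_eq]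
        constructor <;> intro h <;> linarith
      rw [this, floor_vol _ hp, rkW]
      refine if_congr ?_ rfl rfl
      rw [hc]
      push_cast
      constructor <;> rintro ⟨b1, b2⟩ <;> constructor <;> linarith
    have e2 : ∀ i, ∫⁻ v, rkW j v i ∂μ = ∫⁻ v, rkW j v (Fin.last m) ∂μ := by
      intro i
      have hx := hexch (Equiv.swap i (Fin.last m))
      have hx' : μ = Measure.map (fun ω => fun k => V (Equiv.swap i (Fin.last m) k) ω) ℙ :=
        hx.symm
      conv_rhs => rw [hx']
      rw [lintegral_map (rk_meas j (Fin.last m)) (measurable_pi_iff.2 fun k => hVmeas _), hμ,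
        lintegral_map (rk_meas j i) hWm]
      refine lintegral_congr fun ω => ?_
      have := rk_perm j (W ω) (Equiv.swap i (Fin.last m)) (Fin.last m)
      rw [Equiv.swap_apply_right] at this
      exact this.symm
    have e3 : ∑ i, ∫⁻ v, rkW j v i ∂μ = 1 := by
      rw [← lintegral_finsetSum _ fun i _ => rk_meas j i]
      simp_rw [rk_sum j h1 (by exact_mod_cast h2)]
      simp
    simp_rw [e2] at e3
    rw [Finset.sum_const, nsmul_eq_mul, ← e1] at e3
    simp only [Finset.card_univ, Fintype.card_fin, Nat.cast_add, Nat.cast_one] at e3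
    exact ENNReal.eq_inv_of_mul_eq_one_left (by rw [mul_comm]; exact e3)
  refine ⟨part1, ?_⟩
  have hUm : Measurable U := by
    have : U = fun ω => ((R ω : ℝ) - 1 + ζ ω) / (m + 1) := funext hU
    rw [this]
    have : Measurable fun ω => (R ω : ℝ) :=
      (measurable_from_top (f := fun n : ℤ => (n : ℝ))).comp hRm'
    fun_prop
  have hc : ((m + 1 : ℕ) : ℝ≥0∞) = (m : ℝ≥0∞) + 1 := by push_cast; rfl
  have hdisj : ∀ (P : ℕ → Set Ω), Set.PairwiseDisjoint (↑(Finset.range (m + 1)))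
      (fun k : ℕ => {ω | R ω = (k : ℤ) + 1} ∩ P k) := by
    intro P a _ b _ hab
    refine Set.disjoint_left.2 ?_
    rintro ω ⟨h1, _⟩ ⟨h2, _⟩
    simp only [Set.mem_ofPred_eq] at h1 h2
    omega
  have hRk : ∀ k : ℕ, MeasurableSet {ω | R ω = (k : ℤ) + 1} := fun k =>
    hRm' (measurableSet_singleton _)
  have hae : ∀ᵐ ω ∂ℙ, ω ∈ ⋃ k ∈ Finset.range (m + 1), {ω | R ω = (k : ℤ) + 1} ∩ Set.univ := by
    change _ ∈ ae _
    rw [mem_ae_iff]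
    change ℙ (⋃ k ∈ Finset.range (m + 1), {ω | R ω = (k : ℤ) + 1} ∩ Set.univ)ᶜ = 0
    rw [prob_compl_eq_zero_iff]
    · rw [measure_biUnion_finset (hdisj _) fun k _ => (hRk k).inter MeasurableSet.univ]
      rw [Finset.sum_congr rfl (g := fun _ => (m + 1 : ℝ≥0∞)⁻¹)]
      · rw [Finset.sum_const, nsmul_eq_mul, Finset.card_range, hc]
        exact ENNReal.mul_inv_cancel (by simp) (by simp)
      · intro k hk
        rw [Set.inter_univ]
        have := Finset.mem_range.1 hk
        exact part1 _ (by omega) (by omega)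
    · exact Finset.measurableSet_biUnion _ fun k _ => (hRk k).inter MeasurableSet.univ
  ext A hA
  rw [Measure.map_apply hUm hA]
  have hsplit : ℙ (U ⁻¹' A) = ∑ k ∈ Finset.range (m + 1),
      ℙ ({ω | R ω = (k : ℤ) + 1} ∩ U ⁻¹' A) := by
    rw [← measure_biUnion_finset (hdisj fun _ => U ⁻¹' A) fun k _ => (hRk k).inter (hUm hA)]
    apply measure_congr
    rw [Filter.eventuallyEq_set]
    filter_upwards [hae] with ω hω
    simp only [Set.mem_iUnion, Set.mem_inter_iff, Set.mem_univ, and_true] at hω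
    obtain ⟨k, hk, hk'⟩ := hω
    simp only [Set.mem_iUnion, Set.mem_inter_iff]
    exact ⟨fun h => ⟨k, hk, hk', h⟩, fun ⟨_, _, _, h⟩ => h⟩
  have hterm : ∀ k ∈ Finset.range (m + 1), ℙ ({ω | R ω = (k : ℤ) + 1} ∩ U ⁻¹' A) =
      volume (A ∩ Set.Ico ((k:ℝ) / (m + 1 : ℕ)) (((k:ℝ) + 1) / (m + 1 : ℕ))) := by
    intro k hk
    have hk := Finset.mem_range.1 hk
    rw [← vol_scale (m + 1) (Nat.succ_pos m) A hA k]
    have hj : MeasurableSet {p | F p = (k : ℤ) + 1} := hFm (measurableSet_singleton _)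
    have hz : MeasurableSet {z : ℝ | ((k:ℝ) + z) / (m + 1 : ℕ) ∈ A} :=
      (show Measurable fun z : ℝ => ((k:ℝ) + z) / (m + 1 : ℕ) by fun_prop) hA
    have hs : {ω | R ω = (k : ℤ) + 1} ∩ U ⁻¹' A = (fun ω => (ζ ω, (W ω, η ω))) ⁻¹'
        ({z : ℝ | ((k:ℝ) + z) / (m + 1 : ℕ) ∈ A} ×ˢ {p | F p = (k : ℤ) + 1}) := by
      ext ω
      simp only [Set.mem_inter_iff, Set.mem_ofPred_eq, Set.mem_preimage, Set.mem_prod, ← hRF]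
      rw [and_comm]
      refine and_congr_left fun h => ?_
      rw [hU, h]
      push_cast
      rw [add_sub_cancel_right]
    rw [hs, mp4.measure_preimage (hz.prod hj).nullMeasurableSet, Measure.prod_prod, mul_comm,
      ← mp5.measure_preimage hj.nullMeasurableSet]
    congr 1
    rw [hc, ← part1 ((k : ℤ) + 1) (by omega) (by omega)]
    congr 1
    ext ω
    simp [hRF]
  rw [hsplit, Finset.sum_congr rfl hterm, ← vol_split (m + 1) (Nat.succ_pos m) A hA (m + 1),
    div_self (by positivity), hlam,
    Measure.restrict_congr_set (Ioo_ae_eq_Ico (μ := volume) (a := (0:ℝ)) (b := 1)),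
    Measure.restrict_apply hA]
end
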